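/- arXiv:1707.03766 — 2 statements merged into one kernel-verified Lean document; each statement's English description precedes it below -/
import Mathlib

section
/- Let u be an arbitrary word and v, w nonempty words over V. Then u ↗ (vw) = Σ_{u=u¹u²} (u¹ ↘ v)(u² ∧ w), where vw and the juxtaposition on the right denote concatenation and the sum runs over all cuts of u (with the empty-word conventions for the quadri-algebra operations). -/
open Finset MonoidAlgebra TensorProduct

/-- `Sh(p,q)`: permutations of the `p+q` indices that are increasing on the
first `p` indices and on the last `q` indices. -/
def IsSh (p q : ℕ) (σ : Equiv.Perm (Fin (p + q))) : Prop :=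
  (∀ i j : Fin (p + q), (i : ℕ) < (j : ℕ) → (j : ℕ) < p → σ i < σ j) ∧
  (∀ i j : Fin (p + q), p ≤ (i : ℕ) → (i : ℕ) < (j : ℕ) → σ i < σ j)

instance IsSh.decPred (p q : ℕ) : DecidablePred (IsSh p q) := fun _ => by
  unfold IsSh; infer_instance

/-- The word `u_{σ⁻¹(1)} u_{σ⁻¹(2)} ⋯ u_{σ⁻¹(p+q)}` where `u₁ ⋯ u_p` is `u` and
`u_{p+1} ⋯ u_{p+q}` is `v`. -/
def shWord {V : Type*} (u v : List V) (σ : Equiv.Perm (Fin (u.length + v.length))) :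
    FreeMonoid V :=
  FreeMonoid.ofList
    (List.ofFn fun i => (u ++ v).get (Fin.cast (@List.length_append _ u v).symm (σ.symm i)))

/-- `posCond p b i` says that the letter at (combined) index `i` comes from the second
word (`b = true`, i.e. `p ≤ i`) or from the first word (`b = false`, i.e. `i < p`). -/
def posCond (p : ℕ) (b : Bool) (i : ℕ) : Prop :=
  match b with
  | true => p ≤ i
  | false => i < p

instance posCond.dec (p : ℕ) (b : Bool) (i : ℕ) : Decidable (posCond p b i) := by
  cases b <;> unfold posCond <;> infer_instance

variable (k : Type*) [CommRing k] {V : Type*}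

/-- The shuffle product `u ⧢ v` of two words, as an element of the monoid algebra
`H` of the free monoid on `V` (sum over all `(p,q)`-shuffles); in particular
`1 ⧢ a = a ⧢ 1 = a`. -/
noncomputable def shuffleProd (u v : List V) : MonoidAlgebra k (FreeMonoid V) :=
  ∑ σ ∈ univ.filter (IsSh u.length v.length),
    MonoidAlgebra.single (shWord u v σ) (1 : k)

/-- Generic quadri-algebra operation on words: the part of the shuffle product `u ⧢ v`
consisting of the shuffles where the first (resp. last) letter comes from `v` iff `fb`
(resp. `lb`) is `true`.  (For a shuffle permutation, the first letter comes from `v`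
iff `σ⁻¹(1) = p+1`, and from `u` iff `σ⁻¹(1) = 1`; the last letter comes from `v` iff
`σ⁻¹(p+q) = p+q`, and from `u` iff `σ⁻¹(p+q) = p`.)  This definition also encodes the
empty-word conventions: `1 ↘ a = a` and `a ↖ 1 = a` for nonempty `a`, and all other
quadri-algebra operations with an empty argument are `0`. -/
noncomputable def quadOp (fb lb : Bool) (u v : List V) : MonoidAlgebra k (FreeMonoid V) :=
  ∑ σ ∈ univ.filter (fun σ : Equiv.Perm (Fin (u.length + v.length)) =>
      IsSh u.length v.length σ ∧
      ∃ h : 0 < u.length + v.length,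
        posCond u.length fb (σ.symm ⟨0, h⟩) ∧
        posCond u.length lb (σ.symm ⟨u.length + v.length - 1, Nat.sub_lt h Nat.one_pos⟩)),
    MonoidAlgebra.single (shWord u v σ) (1 : k)

/-- `u ↘ v` : shuffles whose first and last letters come from `v`. -/
noncomputable def seOp (u v : List V) : MonoidAlgebra k (FreeMonoid V) := quadOp k true true u v

/-- `u ↗ v` : shuffles whose first letter comes from `v` and last letter from `u`. -/
noncomputable def neOp (u v : List V) : MonoidAlgebra k (FreeMonoid V) := quadOp k true false u v

/-- `u ↖ v` : shuffles whose first and last letters come from `u`. -/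
noncomputable def nwOp (u v : List V) : MonoidAlgebra k (FreeMonoid V) := quadOp k false false u v

/-- `u ↙ v` : shuffles whose first letter comes from `u` and last letter from `v`. -/
noncomputable def swOp (u v : List V) : MonoidAlgebra k (FreeMonoid V) := quadOp k false true u v

/-- `u ≻ v := u ↗ v + u ↘ v`. -/
noncomputable def succOp (u v : List V) : MonoidAlgebra k (FreeMonoid V) := neOp k u v + seOp k u v

/-- `u ≺ v := u ↖ v + u ↙ v`. -/
noncomputable def precOp (u v : List V) : MonoidAlgebra k (FreeMonoid V) := nwOp k u v + swOp k u v

/-- `u ∨ v := u ↘ v + u ↙ v`. -/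
noncomputable def veeOp (u v : List V) : MonoidAlgebra k (FreeMonoid V) := seOp k u v + swOp k u v

/-- `u ∧ v := u ↗ v + u ↖ v`. -/
noncomputable def wedgeOp (u v : List V) : MonoidAlgebra k (FreeMonoid V) := neOp k u v + nwOp k u v

def mrg {V : Type*} : List Bool → List V → List V → List V
  | [], _, _ => []
  | true :: bs, u, v => v.head?.toList ++ mrg bs u v.tail
  | false :: bs, u, v => u.head?.toList ++ mrg bs u.tail v

def BB (p q : ℕ) : Finset (List Bool) :=
  (List.replicate p false ++ List.replicate q true).permutations.toFinset

theorem mem_BB {p q : ℕ} {bs : List Bool} :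
    bs ∈ BB p q ↔ bs.count false = p ∧ bs.count true = q := by
  simp [BB, List.mem_permutations, List.perm_iff_count, List.count_replicate]

theorem mrg_append {V : Type*} (bs cs : List Bool) (u v : List V) :
    mrg (bs ++ cs) u v = mrg bs (u.take (bs.count false)) (v.take (bs.count true)) ++
      mrg cs (u.drop (bs.count false)) (v.drop (bs.count true)) := by
  induction bs generalizing u v with
  | nil => simp [mrg]
  | cons b bs ih =>
    cases b
    · cases u <;> simp [mrg, ih]
    · cases v <;> simp [mrg, ih]

theorem mrg_getElem? {V : Type*} (bs : List Bool) (u v : List V) (hu : bs.count false = u.length)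
    (hv : bs.count true = v.length) (i : ℕ) (hi : i < bs.length) :
    (mrg bs u v)[i]? = if bs[i]? = some true then v[(bs.take i).count true]?
      else u[(bs.take i).count false]? := by
  induction bs generalizing u v i with
  | nil => simp at hi
  | cons b bs ih =>
    cases b
    · cases u with
      | nil => simp at hu
      | cons a u =>
        cases i with
        | zero => simp [mrg]
        | succ i =>
          have := ih u v (by simpa using hu) (by simpa using hv) i (by simpa using hi)
          simpa [mrg] using this
    · cases v with
      | nil => simp at hv
      | cons a u' =>
        cases i with
        | zero => simp [mrg]
        | succ i =>
          have := ih u u' (by simpa using hu) (by simpa using hv) i (by simpa using hi)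
          simpa [mrg] using this

theorem mrg_length {V : Type*} (bs : List Bool) (u v : List V) (hu : bs.count false = u.length)
    (hv : bs.count true = v.length) : (mrg bs u v).length = u.length + v.length := by
  induction bs generalizing u v with
  | nil => simp at hu hv; simp [mrg, ← hu, ← hv]
  | cons b bs ih =>
    cases b
    · cases u with
      | nil => simp at hu
      | cons a u =>
        have := ih u v (by simpa using hu) (by simpa using hv)
        simp [mrg, this]; omega
    · cases v with
      | nil => simp at hv
      | cons a u' =>
        have := ih u u' (by simpa using hu) (by simpa using hv)
        simp [mrg, this]; omega

theorem count_take_ofFn {n : ℕ} (f : Fin n → Bool) (b : Bool) (i : ℕ) (hi : i ≤ n) :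
    ((List.ofFn f).take i).count b = #{j : Fin n | (j : ℕ) < i ∧ f j = b} := by
  induction i with
  | zero => simp
  | succ i ih =>
    have hin : i < n := by omega
    rw [List.take_add_one, List.count_append, ih (by omega)]
    have : (List.ofFn f)[i]? = some (f ⟨i, hin⟩) := by simp [hin]
    rw [this]
    by_cases h : f ⟨i, hin⟩ = b
    · have e : (univ.filter fun j : Fin n => (j : ℕ) < i + 1 ∧ f j = b) =
        insert ⟨i, hin⟩ (univ.filter fun j : Fin n => (j : ℕ) < i ∧ f j = b) := by
        ext j
        simp only [mem_filter, mem_univ, true_and, mem_insert, Fin.ext_iff]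
        constructor
        · rintro ⟨h1, h2⟩
          by_cases h3 : (j : ℕ) = i
          · exact Or.inl h3
          · exact Or.inr ⟨by omega, h2⟩
        · rintro (h1 | ⟨h1, h2⟩)
          · have : j = ⟨i, hin⟩ := Fin.ext h1
            exact ⟨by omega, this ▸ h⟩
          · exact ⟨by omega, h2⟩
      rw [e, card_insert_of_notMem (by simp)]
      simp [h]
    · have e : (univ.filter fun j : Fin n => (j : ℕ) < i + 1 ∧ f j = b) =
        (univ.filter fun j : Fin n => (j : ℕ) < i ∧ f j = b) := by
        ext j
        simp only [mem_filter, mem_univ, true_and]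
        constructor
        · rintro ⟨h1, h2⟩
          by_cases h3 : (j : ℕ) = i
          · have : j = ⟨i, hin⟩ := Fin.ext h3
            exact absurd (this ▸ h2) h
          · exact ⟨by omega, h2⟩
        · rintro ⟨h1, h2⟩
          exact ⟨by omega, h2⟩
      rw [e]
      simp [h]

def bl {p q : ℕ} (σ : Equiv.Perm (Fin (p + q))) : List Bool :=
  List.ofFn fun i => decide (p ≤ (σ.symm i : ℕ))

theorem card_fin_pred (n : ℕ) (P : ℕ → Prop) [DecidablePred P] :
    #{j : Fin n | P j} = #{j ∈ Finset.range n | P j} := by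
  rw [← Finset.card_map Fin.valEmbedding]
  congr 1
  ext j
  simp only [mem_map, mem_filter, mem_univ, true_and, mem_range, Fin.valEmbedding_apply]
  constructor
  · rintro ⟨a, h, rfl⟩; exact ⟨a.2, h⟩
  · rintro ⟨h, h'⟩; exact ⟨⟨j, h⟩, h', rfl⟩

theorem card_symm {n : ℕ} (σ : Equiv.Perm (Fin n)) (P : Fin n → Prop) [DecidablePred P] :
    #{j : Fin n | P j} = #{j : Fin n | P (σ j)} := by
  symm
  apply Finset.card_bij (fun j _ => σ j)
  · simp
  · simp
  · intro b hb
    exact ⟨σ.symm b, by simpa using hb, by simp⟩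

theorem bl_count_true {p q : ℕ} (σ : Equiv.Perm (Fin (p + q))) : (bl σ).count true = q := by
  have := count_take_ofFn (fun i => decide (p ≤ (σ.symm i : ℕ))) true (p + q) le_rfl
  rw [List.take_of_length_le (by simp)] at this
  rw [bl, this, card_symm σ]
  simp only [Equiv.symm_apply_apply, decide_eq_true_eq, Fin.is_lt, true_and]
  rw [card_fin_pred (p + q) (fun j => p ≤ j)]
  have : (Finset.range (p + q)).filter (fun j => p ≤ j) = Finset.Ico p (p + q) := by
    ext; simp; omega
  rw [this]; simp

theorem bl_count_false {p q : ℕ} (σ : Equiv.Perm (Fin (p + q))) : (bl σ).count false = p := by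
  have h := bl_count_true σ
  have h2 : (bl σ).length = p + q := by simp [bl]
  have := List.count_not_add_count (bl σ) true
  simp only [Bool.not_true] at this
  omega

theorem bl_take_true {p q : ℕ} (σ : Equiv.Perm (Fin (p + q))) (hσ : IsSh p q σ)
    (i : Fin (p + q)) (h : p ≤ (σ.symm i : ℕ)) :
    ((bl σ).take i).count true = (σ.symm i : ℕ) - p := by
  obtain ⟨m, rfl⟩ := σ.surjective i
  simp only [Equiv.symm_apply_apply] at h ⊢
  rw [bl, count_take_ofFn _ _ _ (σ m).2.le, card_symm σ]
  simp only [Equiv.symm_apply_apply, decide_eq_true_eq]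
  have e : (univ.filter fun j : Fin (p + q) => (σ j : ℕ) < σ m ∧ p ≤ (j : ℕ)) =
      univ.filter fun j : Fin (p + q) => p ≤ (j : ℕ) ∧ (j : ℕ) < m := by
    ext j
    simp only [mem_filter, mem_univ, true_and]
    constructor
    · rintro ⟨h1, h2⟩
      refine ⟨h2, ?_⟩
      by_contra hc
      rcases (not_lt.1 hc).eq_or_lt with h3 | h3
      · rw [Fin.ext h3] at h1; omega
      · have := hσ.2 m j h h3
        rw [Fin.lt_def] at this; omega
    · rintro ⟨h1, h2⟩
      exact ⟨hσ.2 j m h1 h2, h1⟩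
  rw [e, card_fin_pred (p + q) (fun j => p ≤ j ∧ j < m)]
  have : (Finset.range (p + q)).filter (fun j => p ≤ j ∧ j < m) = Finset.Ico p m := by
    ext; simp; omega
  rw [this]; simp

theorem bl_take_false {p q : ℕ} (σ : Equiv.Perm (Fin (p + q))) (hσ : IsSh p q σ)
    (i : Fin (p + q)) (h : (σ.symm i : ℕ) < p) :
    ((bl σ).take i).count false = (σ.symm i : ℕ) := by
  obtain ⟨m, rfl⟩ := σ.surjective i
  simp only [Equiv.symm_apply_apply] at h ⊢
  rw [bl, count_take_ofFn _ _ _ (σ m).2.le, card_symm σ]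
  simp only [Equiv.symm_apply_apply, decide_eq_false_iff_not, not_le]
  have e : (univ.filter fun j : Fin (p + q) => (σ j : ℕ) < σ m ∧ (j : ℕ) < p) =
      univ.filter fun j : Fin (p + q) => (j : ℕ) < m := by
    ext j
    simp only [mem_filter, mem_univ, true_and]
    constructor
    · rintro ⟨h1, h2⟩
      by_contra hc
      rcases (not_lt.1 hc).eq_or_lt with h3 | h3
      · rw [Fin.ext h3] at h1; omega
      · have := hσ.1 m j h3 h2
        rw [Fin.lt_def] at this; omega
    · intro h2
      exact ⟨hσ.1 j m h2 h, by omega⟩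
  rw [e, card_fin_pred (p + q) (fun j => j < (m : ℕ))]
  have : (Finset.range (p + q)).filter (fun j => j < (m : ℕ)) = Finset.range m := by
    ext; simp; omega
  rw [this]; simp

theorem bl_getElem {p q : ℕ} (σ : Equiv.Perm (Fin (p + q))) (i : ℕ) (hi : i < p + q) :
    (bl σ)[i]? = some (decide (p ≤ (σ.symm ⟨i, hi⟩ : ℕ))) := by
  simp [bl, hi]

theorem bl_inj {p q : ℕ} (σ τ : Equiv.Perm (Fin (p + q))) (hσ : IsSh p q σ) (hτ : IsSh p q τ)
    (h : bl σ = bl τ) : σ = τ := by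
  have : σ.symm = τ.symm := by
    ext i
    have h1 := bl_getElem σ i i.2
    have h2 := bl_getElem τ i i.2
    rw [h, h2] at h1
    simp only [Fin.eta, Option.some.injEq, decide_eq_decide] at h1
    by_cases hp : p ≤ (σ.symm i : ℕ)
    · have h3 := bl_take_true σ hσ i hp
      have h4 := bl_take_true τ hτ i (h1.2 hp)
      have := h1.2 hp
      rw [h] at h3; omega
    · have hp' : ¬ p ≤ (τ.symm i : ℕ) := fun h' => hp (h1.1 h')
      have h3 := bl_take_false σ hσ i (by omega)
      have h4 := bl_take_false τ hτ i (by omega)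
      rw [h] at h3; omega
  simpa using congrArg Equiv.symm this

theorem bl_surj {p q : ℕ} (bs : List Bool) (h : bs ∈ BB p q) :
    ∃ σ : Equiv.Perm (Fin (p + q)), IsSh p q σ ∧ bl σ = bs := by
  obtain ⟨hf, ht⟩ := mem_BB.1 h
  have hl : bs.length = p + q := by
    have := List.count_not_add_count bs true
    simp only [Bool.not_true] at this
    omega
  obtain ⟨f, rfl⟩ : ∃ f : Fin (p + q) → Bool, bs = List.ofFn f := by
    refine ⟨fun i => bs.get ⟨i, by omega⟩, ?_⟩
    apply List.ext_getElem <;> simp [hl]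
  have c := fun b => count_take_ofFn f b (p + q) le_rfl
  rw [List.take_of_length_le (by simp)] at c
  simp only [Fin.is_lt, true_and] at c
  let s : Finset (Fin (p + q)) := {j | f j = false}
  have hs : #s = p := by rw [← c, hf]
  have hs' : #sᶜ = q := by
    rw [card_compl, hs]; simp
  let σ : Equiv.Perm (Fin (p + q)) := finSumFinEquiv.symm.trans (finSumEquivOfFinset hs hs')
  have a1 : ∀ (j : ℕ) (hj : j < p) (hj' : j < p + q), σ ⟨j, hj'⟩ = s.orderEmbOfFin hs ⟨j, hj⟩ := by
    intro j hj hj'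
    have : (⟨j, hj'⟩ : Fin (p + q)) = Fin.castAdd q ⟨j, hj⟩ := rfl
    rw [this, Equiv.trans_apply, finSumFinEquiv_symm_apply_castAdd, finSumEquivOfFinset_inl]
  have a2 : ∀ (j : ℕ) (hj : p ≤ j) (hj' : j < p + q),
      σ ⟨j, hj'⟩ = sᶜ.orderEmbOfFin hs' ⟨j - p, by omega⟩ := by
    intro j hj hj'
    have : (⟨j, hj'⟩ : Fin (p + q)) = Fin.natAdd p ⟨j - p, by omega⟩ := by
      ext; simp; omega
    rw [this, Equiv.trans_apply, finSumFinEquiv_symm_apply_natAdd, finSumEquivOfFinset_inr]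
  refine ⟨σ, ⟨?_, ?_⟩, ?_⟩
  · intro i j hij hj
    rw [a1 i (by omega) i.2, a1 j hj j.2]
    simpa using hij
  · intro i j hi hij
    rw [a2 i (by omega) i.2, a2 j (by omega) j.2]
    simp; omega
  · unfold bl
    congr 1
    ext i
    obtain ⟨m, rfl⟩ := σ.surjective i
    simp only [Equiv.symm_apply_apply]
    by_cases hm : p ≤ (m : ℕ)
    · have := Finset.orderEmbOfFin_mem sᶜ hs' ⟨m - p, by omega⟩
      rw [← a2 m hm m.2] at this
      simpa [s, hm] using this
    · have := Finset.orderEmbOfFin_mem s hs ⟨m, by omega⟩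
      rw [← a1 m (by omega) m.2] at this
      simp [s] at this
      simp [hm, this]

theorem shWord_eq {V : Type*} (u v : List V) (σ : Equiv.Perm (Fin (u.length + v.length)))
    (hσ : IsSh u.length v.length σ) : shWord u v σ = FreeMonoid.ofList (mrg (bl σ) u v) := by
  unfold shWord
  congr 1
  have hlen := mrg_length (bl σ) u v (bl_count_false σ) (bl_count_true σ)
  have hl : (bl σ).length = u.length + v.length := by simp [bl]
  apply List.ext_getElem?
  intro i
  by_cases hi : i < u.length + v.length
  · rw [mrg_getElem? _ _ _ (bl_count_false σ) (bl_count_true σ) i (by omega)]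
    rw [bl_getElem σ i hi]
    have h0 : (List.ofFn fun i => (u ++ v).get
        (Fin.cast (@List.length_append _ u v).symm (σ.symm i)))[i]? =
        (u ++ v)[(σ.symm ⟨i, hi⟩ : ℕ)]? := by
      rw [List.getElem?_eq_getElem (by simpa using hi), List.getElem?_eq_getElem (by simp)]
      simp
    rw [h0]
    by_cases hp : u.length ≤ (σ.symm ⟨i, hi⟩ : ℕ)
    · have := bl_take_true σ hσ ⟨i, hi⟩ hp
      simp only at this
      rw [this, List.getElem?_append_right hp]
      simp [hp]
    · have := bl_take_false σ hσ ⟨i, hi⟩ (by omega)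
      simp only at this
      rw [this, List.getElem?_append_left (by omega)]
      simp [hp]
  · rw [List.getElem?_eq_none (by simpa using hi), List.getElem?_eq_none (by omega)]

theorem posCond_iff (p : ℕ) (b : Bool) (i : ℕ) : posCond p b i ↔ decide (p ≤ i) = b := by
  cases b <;> simp [posCond]

theorem quadOp_eq (fb lb : Bool) (u v : List V) :
    quadOp k fb lb u v = ∑ bs ∈ (BB u.length v.length).filter
      (fun bs => bs.head? = some fb ∧ bs.getLast? = some lb),
      MonoidAlgebra.single (FreeMonoid.ofList (mrg bs u v)) (1 : k) := by
  have key : ∀ σ : Equiv.Perm (Fin (u.length + v.length)),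
      ((bl σ).head? = some fb ∧ (bl σ).getLast? = some lb) ↔
      ∃ h : 0 < u.length + v.length,
        posCond u.length fb (σ.symm ⟨0, h⟩) ∧
        posCond u.length lb (σ.symm ⟨u.length + v.length - 1, Nat.sub_lt h Nat.one_pos⟩) := by
    intro σ
    have hl : (bl σ).length = u.length + v.length := by simp [bl]
    rw [List.head?_eq_getElem?, List.getLast?_eq_getElem?, hl]
    by_cases h : 0 < u.length + v.length
    · rw [bl_getElem σ 0 h, bl_getElem σ _ (Nat.sub_lt h Nat.one_pos)]
      simp only [posCond_iff, Option.some.injEq, h, exists_true_left]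
    · rw [List.getElem?_eq_none (by omega)]
      simp [h]
  unfold quadOp
  refine Finset.sum_bij (fun σ _ => bl σ) ?_ ?_ ?_ ?_
  · intro σ hσ
    simp only [mem_filter, mem_univ, true_and] at hσ ⊢
    exact ⟨mem_BB.2 ⟨bl_count_false σ, bl_count_true σ⟩, (key σ).2 hσ.2⟩
  · intro σ hσ τ hτ h
    simp only [mem_filter, mem_univ, true_and] at hσ hτ
    exact bl_inj σ τ hσ.1 hτ.1 h
  · intro bs hbs
    simp only [mem_filter] at hbs
    obtain ⟨σ, hσ, rfl⟩ := bl_surj bs hbs.1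
    refine ⟨σ, ?_, rfl⟩
    simp only [mem_filter, mem_univ, true_and]
    exact ⟨hσ, (key σ).1 hbs.2⟩
  · intro σ hσ
    simp only [mem_filter, mem_univ, true_and] at hσ
    rw [shWord_eq u v σ hσ.1]

theorem wedgeOp_eq (u v : List V) :
    wedgeOp k u v = ∑ bs ∈ (BB u.length v.length).filter
      (fun bs => bs.getLast? = some false),
      MonoidAlgebra.single (FreeMonoid.ofList (mrg bs u v)) (1 : k) := by
  unfold wedgeOp neOp nwOp
  rw [quadOp_eq, quadOp_eq, ← Finset.sum_union]
  · congr 1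
    ext bs
    simp only [mem_union, mem_filter]
    rcases bs with _ | ⟨b, bs⟩
    · simp
    · cases b <;> simp
  · rw [Finset.disjoint_left]
    intro bs h1 h2
    simp only [mem_filter] at h1 h2
    simp [h1.2.1] at h2

theorem exists_split (q : ℕ) (bs : List Bool) (hq : 0 < q) (h : q ≤ bs.count true) :
    ∃ x y, bs = x ++ y ∧ x.count true = q ∧ x.getLast? = some true := by
  induction bs generalizing q with
  | nil => simp at h; omega
  | cons b bs ih =>
    cases b
    · obtain ⟨x, y, rfl, h1, h2⟩ := ih q hq (by simpa using h)
      exact ⟨false :: x, y, by simp, by simpa using h1, by simp [List.getLast?_cons, h2]⟩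
    · by_cases hq1 : q = 1
      · exact ⟨[true], bs, by simp, by simp [hq1], by simp⟩
      · obtain ⟨x, y, rfl, h1, h2⟩ := ih (q - 1) (by omega) (by simp at h; omega)
        exact ⟨true :: x, y, by simp, by simp [h1]; omega, by simp [List.getLast?_cons, h2]⟩

theorem split_aux (x a : List Bool) (h : x.count true = (x ++ a).count true)
    (hl : (x ++ a).getLast? = some true) : a = [] := by
  by_contra ha
  rw [List.getLast?_append_of_ne_nil _ ha] at hl
  have := List.mem_of_getLast? hl
  have := List.count_pos_iff.2 this
  simp at h
  rw [List.count_eq_zero] at h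
  exact h (List.mem_of_getLast? hl)

theorem split_unique (x y x' y' : List Bool) (h : x ++ y = x' ++ y')
    (hc : x.count true = x'.count true) (hx : x.getLast? = some true)
    (hx' : x'.getLast? = some true) : x = x' ∧ y = y' := by
  rcases List.append_eq_append_iff.1 h with ⟨a, rfl, rfl⟩ | ⟨a, rfl, rfl⟩
  · have := split_aux x a hc hx'
    simp [this]
  · have := split_aux x' a hc.symm hx
    simp [this]

theorem statement0 (u v w : List V) (hv : v ≠ []) (hw : w ≠ []) :
    neOp k u (v ++ w) =
      ∑ i ∈ Finset.range (u.length + 1),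
        seOp k (u.take i) v * wedgeOp k (u.drop i) w := by
  have hv' : 0 < v.length := List.length_pos_iff.2 hv
  have hw' : 0 < w.length := List.length_pos_iff.2 hw
  unfold neOp seOp
  simp_rw [wedgeOp_eq, quadOp_eq, Finset.sum_mul_sum, ← Finset.sum_product']
  rw [Finset.sum_sigma']
  symm
  refine Finset.sum_bij (fun z _ => z.2.1 ++ z.2.2) ?_ ?_ ?_ ?_
  · rintro ⟨i, x, y⟩ hz
    simp only [mem_sigma, mem_range, mem_product, mem_filter, mem_BB, List.length_take,
      List.length_drop] at hz
    obtain ⟨hi, ⟨⟨hx1, hx2⟩, hx3, hx4⟩, ⟨hy1, hy2⟩, hy3⟩ := hz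
    simp only [mem_filter, mem_BB, List.count_append, List.length_append]
    refine ⟨⟨by omega, by omega⟩, by simp [hx3], by simp [hy3]⟩
  · rintro ⟨i, x, y⟩ hz ⟨i', x', y'⟩ hz' h
    simp only [mem_sigma, mem_range, mem_product, mem_filter, mem_BB, List.length_take,
      List.length_drop] at hz hz'
    obtain ⟨hi, ⟨⟨hx1, hx2⟩, hx3, hx4⟩, ⟨hy1, hy2⟩, hy3⟩ := hz
    obtain ⟨hi', ⟨⟨hx1', hx2'⟩, hx3', hx4'⟩, ⟨hy1', hy2'⟩, hy3'⟩ := hz'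
    obtain ⟨rfl, rfl⟩ := split_unique x y x' y' h (by omega) hx4 hx4'
    have : i = i' := by omega
    subst this; rfl
  · intro bs hbs
    simp only [mem_filter, mem_BB, List.length_append] at hbs
    obtain ⟨⟨h1, h2⟩, h3, h4⟩ := hbs
    obtain ⟨x, y, rfl, h5, h6⟩ := exists_split v.length bs hv' (by omega)
    rw [List.count_append] at h1 h2
    have hx : x ≠ [] := by rintro rfl; simp at h6
    have hy : y ≠ [] := by rintro rfl; simp at h2; omega
    rw [List.head?_append_of_ne_nil _ hx] at h3
    rw [List.getLast?_append_of_ne_nil _ hy] at h4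
    refine ⟨⟨x.count false, x, y⟩, ?_, rfl⟩
    simp only [mem_sigma, mem_range, mem_product, mem_filter, mem_BB, List.length_take,
      List.length_drop]
    refine ⟨by omega, ⟨⟨by omega, h5⟩, h3, h6⟩, ⟨by omega, by omega⟩, h4⟩
  · rintro ⟨i, x, y⟩ hz
    simp only [mem_sigma, mem_range, mem_product, mem_filter, mem_BB, List.length_take,
      List.length_drop] at hz
    obtain ⟨hi, ⟨⟨hx1, hx2⟩, hx3, hx4⟩, ⟨hy1, hy2⟩, hy3⟩ := hz
    have hxi : x.count false = i := by omega
    simp only [MonoidAlgebra.single_mul_single, mul_one]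
    rw [mrg_append, hxi, hx2]
    simp [FreeMonoid.ofList_append]
end

section
/- Let u be an arbitrary word and v, w nonempty words over V. Then u ↘ (vw) = Σ_{u=u¹u²} (u¹ ≻ v)(u² ↘ w), where vw and the juxtaposition on the right denote concatenation and the sum runs over all cuts of u (with the empty-word conventions for the quadri-algebra operations). -/
open Finset MonoidAlgebra TensorProduct

variable (k : Type*) [CommRing k] {V : Type*}

section helpers

/-- first letter from the second word -/
def CondA (p q : ℕ) (σ : Equiv.Perm (Fin (p + q))) : Prop :=
  IsSh p q σ ∧ ∀ x, (σ x : ℕ) = 0 → p ≤ (x : ℕ)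

/-- first and last letters from the second word -/
def CondB (p q : ℕ) (σ : Equiv.Perm (Fin (p + q))) : Prop :=
  CondA p q σ ∧ ∀ x, (σ x : ℕ) + 1 = p + q → p ≤ (x : ℕ)

/-- combined letters -/
def letr {V : Type*} (u v : List V) (p q : ℕ) (hp : u.length = p) (hq : v.length = q)
    (x : Fin (p + q)) : V :=
  (u ++ v)[(x : ℕ)]'(by have := x.2; simp only [List.length_append]; omega)

open Classical in
/-- sum over perms satisfying a predicate -/
noncomputable def permSum (k : Type*) [CommRing k] {V : Type*} (n : ℕ)
    (P : Equiv.Perm (Fin n) → Prop) (g : Fin n → V) : MonoidAlgebra k (FreeMonoid V) :=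
  ∑ σ ∈ univ.filter P, MonoidAlgebra.single
    (FreeMonoid.ofList (List.ofFn fun i => g (σ.symm i))) (1 : k)

theorem first_iff (p q : ℕ) (σ : Equiv.Perm (Fin (p + q))) (h : 0 < p + q) :
    p ≤ (σ.symm ⟨0, h⟩ : ℕ) ↔ ∀ x, (σ x : ℕ) = 0 → p ≤ (x : ℕ) := by
  constructor
  · intro H x hx
    have : σ x = ⟨0, h⟩ := Fin.ext hx
    rw [← this] at H
    simpa using H
  · intro H
    apply H
    simp

theorem last_iff (p q : ℕ) (σ : Equiv.Perm (Fin (p + q))) (h : 0 < p + q) :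
    p ≤ (σ.symm ⟨p + q - 1, Nat.sub_lt h Nat.one_pos⟩ : ℕ) ↔
      ∀ x, (σ x : ℕ) + 1 = p + q → p ≤ (x : ℕ) := by
  constructor
  · intro H x hx
    have : σ x = ⟨p + q - 1, Nat.sub_lt h Nat.one_pos⟩ := Fin.ext (by simp; omega)
    rw [← this] at H
    simpa using H
  · intro H
    apply H
    simp
    omega

theorem seOp_eq (k : Type*) [CommRing k] {V : Type*} (u v : List V) (hv : v ≠ []) (p q : ℕ)
    (hp : u.length = p) (hq : v.length = q) :
    seOp k u v = permSum k (p + q) (CondB p q) (letr u v p q hp hq) := by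
  subst hp hq
  have h : 0 < u.length + v.length := by
    have := List.length_pos_iff.2 hv; omega
  unfold seOp quadOp permSum
  refine Finset.sum_congr ?_ ?_
  · ext σ
    simp only [Finset.mem_filter, Finset.mem_univ, true_and, posCond, CondB, CondA, h,
      exists_true_left, first_iff, last_iff, and_assoc]
  · intro σ _
    rfl

theorem succOp_eq (k : Type*) [CommRing k] {V : Type*} (u v : List V) (hv : v ≠ []) (p q : ℕ)
    (hp : u.length = p) (hq : v.length = q) :
    succOp k u v = permSum k (p + q) (CondA p q) (letr u v p q hp hq) := by
  classical
  subst hp hq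
  have h : 0 < u.length + v.length := by
    have := List.length_pos_iff.2 hv; omega
  unfold succOp neOp seOp quadOp permSum
  rw [← Finset.sum_union]
  · refine Finset.sum_congr ?_ ?_
    · ext σ
      simp only [Finset.mem_filter, Finset.mem_univ, true_and, posCond, CondA, h,
        exists_true_left, Finset.mem_union]
      rw [← first_iff _ _ _ h]
      have := lt_or_ge (σ.symm ⟨u.length + v.length - 1, Nat.sub_lt h Nat.one_pos⟩ : ℕ) u.length
      tauto
    · intro σ _
      rfl
  · rw [Finset.disjoint_left]
    intro σ h1 h2
    simp only [Finset.mem_filter, Finset.mem_univ, true_and, posCond, h,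
        exists_true_left] at h1 h2
    omega

/-- position map -/
def posFun (i j p a b : ℕ) (h : i + j = p) : Fin (i + a) ⊕ Fin (j + b) → Fin (p + (a + b))
  | .inl x => ⟨if (x : ℕ) < i then x else p + (x - i), by have := x.2; split <;> omega⟩
  | .inr y => ⟨if (y : ℕ) < j then i + y else p + a + (y - j), by have := y.2; split <;> omega⟩

/-- position equivalence -/
noncomputable def posE (i j p a b : ℕ) (h : i + j = p) :
    Fin (i + a) ⊕ Fin (j + b) ≃ Fin (p + (a + b)) :=
  Equiv.ofBijective (posFun i j p a b h) (by
    rw [Fintype.bijective_iff_injective_and_card]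
    constructor
    · rintro (x | x) (y | y) hxy <;> simp only [posFun, Fin.mk.injEq] at hxy <;>
        have := x.2 <;> have := y.2
      · congr 1; apply Fin.ext; split_ifs at hxy <;> omega
      · split_ifs at hxy <;> omega
      · split_ifs at hxy <;> omega
      · congr 1; apply Fin.ext; split_ifs at hxy <;> omega
    · simp; omega)

theorem posE_inl (i j p a b : ℕ) (h : i + j = p) (x : Fin (i + a)) :
    (posE i j p a b h (.inl x) : ℕ) = if (x : ℕ) < i then (x : ℕ) else p + (x - i) := rfl

theorem posE_inr (i j p a b : ℕ) (h : i + j = p) (x : Fin (j + b)) :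
    (posE i j p a b h (.inr x) : ℕ) = if (x : ℕ) < j then i + (x : ℕ) else p + a + (x - j) := rfl

/-- concatenation equivalence -/
def catE (i j p a b : ℕ) (h : i + j = p) :
    Fin (i + a) ⊕ Fin (j + b) ≃ Fin (p + (a + b)) :=
  finSumFinEquiv.trans (finCongr (by omega))

theorem catE_inl (i j p a b : ℕ) (h : i + j = p) (x : Fin (i + a)) :
    (catE i j p a b h (.inl x) : ℕ) = x := by simp [catE]

theorem catE_inr (i j p a b : ℕ) (h : i + j = p) (x : Fin (j + b)) :
    (catE i j p a b h (.inr x) : ℕ) = i + a + x := by simp [catE]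

/-- glue two perms -/
noncomputable def glue (i j p a b : ℕ) (h : i + j = p) (σ : Equiv.Perm (Fin (i + a)))
    (τ : Equiv.Perm (Fin (j + b))) : Equiv.Perm (Fin (p + (a + b))) :=
  (posE i j p a b h).symm.trans ((Equiv.sumCongr σ τ).trans (catE i j p a b h))

theorem glue_inl (i j p a b : ℕ) (h : i + j = p) (σ : Equiv.Perm (Fin (i + a)))
    (τ : Equiv.Perm (Fin (j + b))) (x) :
    (glue i j p a b h σ τ (posE i j p a b h (.inl x)) : ℕ) = σ x := by
  simp [glue, catE_inl]

theorem glue_inr (i j p a b : ℕ) (h : i + j = p) (σ : Equiv.Perm (Fin (i + a)))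
    (τ : Equiv.Perm (Fin (j + b))) (x) :
    (glue i j p a b h σ τ (posE i j p a b h (.inr x)) : ℕ) = i + a + τ x := by
  simp [glue, catE_inr]

theorem glue_condB (i j p a b : ℕ) (h : i + j = p) (ha : 0 < a) (hb : 0 < b)
    (σ : Equiv.Perm (Fin (i + a)))
    (τ : Equiv.Perm (Fin (j + b))) (hσ : CondA i a σ) (hτ : CondB j b τ) :
    CondB p (a + b) (glue i j p a b h σ τ) := by
  obtain ⟨⟨s1, s2⟩, s3⟩ := hσ
  obtain ⟨⟨⟨t1, t2⟩, t3⟩, t4⟩ := hτ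
  refine ⟨⟨⟨?_, ?_⟩, ?_⟩, ?_⟩
  · intro x y hxy hy
    obtain ⟨x | x, rfl⟩ := (posE i j p a b h).surjective x <;>
    obtain ⟨y | y, rfl⟩ := (posE i j p a b h).surjective y <;>
    simp only [Fin.lt_def, glue_inl, glue_inr, posE_inl, posE_inr] at hxy hy ⊢
    · exact s1 x y (by split_ifs at hxy hy <;> omega) (by split_ifs at hxy hy <;> omega)
    · have := (σ x).2; omega
    · split_ifs at hxy hy <;> omega
    · have := t1 x y (by split_ifs at hxy hy <;> omega) (by split_ifs at hxy hy <;> omega)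
      rw [Fin.lt_def] at this; omega
  · intro x y hx hxy
    obtain ⟨x | x, rfl⟩ := (posE i j p a b h).surjective x <;>
    obtain ⟨y | y, rfl⟩ := (posE i j p a b h).surjective y <;>
    simp only [Fin.lt_def, glue_inl, glue_inr, posE_inl, posE_inr] at hxy hx ⊢ <;>
    have hx2 := x.2 <;> have hy2 := y.2
    · exact s2 x y (by split_ifs at hxy hx <;> omega) (by split_ifs at hxy hx <;> omega)
    · have := (σ x).2; omega
    · split_ifs at hxy hx <;> omega
    · have := t2 x y (by split_ifs at hxy hx <;> omega) (by split_ifs at hxy hx <;> omega)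
      rw [Fin.lt_def] at this; omega
  · intro x hx
    obtain ⟨x | x, rfl⟩ := (posE i j p a b h).surjective x <;>
    simp only [glue_inl, glue_inr, posE_inl, posE_inr] at hx ⊢
    · have := s3 x hx
      split_ifs <;> omega
    · omega
  · intro x hx
    obtain ⟨x | x, rfl⟩ := (posE i j p a b h).surjective x <;>
    simp only [glue_inl, glue_inr, posE_inl, posE_inr] at hx ⊢
    · have := (σ x).2; omega
    · have := t4 x (by omega)
      split_ifs <;> omega

theorem glue_condB_rev (i j p a b : ℕ) (h : i + j = p) (ha : 0 < a) (hb : 0 < b)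
    (σ : Equiv.Perm (Fin (i + a)))
    (τ : Equiv.Perm (Fin (j + b)))
    (H : CondB p (a + b) (glue i j p a b h σ τ))
    (hc : (τ ⟨j, by omega⟩ : ℕ) = 0) : CondA i a σ ∧ CondB j b τ := by
  obtain ⟨⟨⟨s1, s2⟩, s3⟩, s4⟩ := H
  refine ⟨⟨⟨?_, ?_⟩, ?_⟩, ⟨⟨?_, ?_⟩, ?_⟩, ?_⟩
  · intro x y hxy hy
    have := s1 (posE i j p a b h (.inl x)) (posE i j p a b h (.inl y))
    simp only [Fin.lt_def, glue_inl, posE_inl] at this ⊢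
    exact this (by split_ifs <;> omega) (by split_ifs <;> omega)
  · intro x y hx hxy
    have := s2 (posE i j p a b h (.inl x)) (posE i j p a b h (.inl y))
    simp only [Fin.lt_def, glue_inl, posE_inl] at this ⊢
    exact this (by split_ifs <;> omega) (by split_ifs <;> omega)
  · intro x hx
    have := s3 (posE i j p a b h (.inl x))
    simp only [glue_inl, posE_inl] at this
    have := this hx
    split_ifs at this <;> omega
  · intro x y hxy hy
    have := s1 (posE i j p a b h (.inr x)) (posE i j p a b h (.inr y))
    simp only [Fin.lt_def, glue_inr, posE_inr] at this ⊢
    have := this (by split_ifs <;> omega) (by split_ifs <;> omega)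
    omega
  · intro x y hx hxy
    have := s2 (posE i j p a b h (.inr x)) (posE i j p a b h (.inr y))
    simp only [Fin.lt_def, glue_inr, posE_inr] at this ⊢
    have := this (by split_ifs <;> omega) (by split_ifs <;> omega)
    omega
  · intro x hx
    have : x = ⟨j, by omega⟩ := τ.injective (Fin.ext (by rw [hx, hc]))
    rw [this]
  · intro x hx
    have := s4 (posE i j p a b h (.inr x))
    simp only [glue_inr, posE_inr] at this
    have := this (by omega)
    split_ifs at this <;> omega

theorem condB_zero (j b : ℕ) (hb : 0 < b) (τ : Equiv.Perm (Fin (j + b))) (hτ : CondB j b τ) :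
    (τ ⟨j, by omega⟩ : ℕ) = 0 := by
  obtain ⟨⟨⟨t1, t2⟩, t3⟩, t4⟩ := hτ
  have h0 : 0 < j + b := by omega
  have h1 := t3 (τ.symm ⟨0, h0⟩) (by simp)
  rcases h1.eq_or_lt with h | h
  · have : (⟨j, by omega⟩ : Fin (j + b)) = τ.symm ⟨0, h0⟩ := Fin.ext h
    rw [this]; simp
  · have := t2 ⟨j, by omega⟩ (τ.symm ⟨0, h0⟩) le_rfl h
    simp [Fin.lt_def] at this

theorem exists_glue (p a b : ℕ) (ha : 0 < a) (hb : 0 < b)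
    (ρ : Equiv.Perm (Fin (p + (a + b)))) (H : CondB p (a + b) ρ) :
    ∃ (i j : ℕ) (h : i + j = p) (σ : Equiv.Perm (Fin (i + a))) (τ : Equiv.Perm (Fin (j + b))),
      CondA i a σ ∧ CondB j b τ ∧ glue i j p a b h σ τ = ρ := by
  classical
  have H' := H
  obtain ⟨⟨⟨s1, s2⟩, s3⟩, s4⟩ := H
  let c : Fin (p + (a + b)) := ⟨p + a, by omega⟩
  have hcv : (c : ℕ) = p + a := rfl
  have hex : ∃ i, ∀ hi : i < p, ¬ ρ ⟨i, by omega⟩ < ρ c := ⟨p, fun h => by omega⟩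
  obtain ⟨i, hip, hi⟩ : ∃ i ≤ p, ∀ x : Fin (p + (a + b)), (x : ℕ) < p →
      (ρ x < ρ c ↔ (x : ℕ) < i) := by
    refine ⟨Nat.find hex, Nat.find_min' hex (fun h => by omega), ?_⟩
    intro x hx
    constructor
    · intro hlt
      by_contra hge
      have hge : Nat.find hex ≤ (x : ℕ) := by omega
      have hsp := Nat.find_spec hex (by omega)
      rcases hge.eq_or_lt with h | h
      · apply hsp
        have : (⟨Nat.find hex, by omega⟩ : Fin (p + (a + b))) = x := Fin.ext h
        rwa [this]
      · exact hsp ((s1 ⟨Nat.find hex, by omega⟩ x h hx).trans hlt)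
    · intro hlt
      have := Nat.find_min hex hlt
      push Not at this
      exact this.2
  obtain ⟨j, h⟩ := Nat.exists_eq_add_of_le hip
  have h : i + j = p := h.symm
  have hl : ∀ x, ρ (posE i j p a b h (.inl x)) < ρ c := by
    intro x
    have hx2 := x.2
    by_cases hx : (x : ℕ) < i
    · rw [hi] <;> rw [posE_inl, if_pos hx] <;> omega
    · apply s2 <;> rw [posE_inl, if_neg hx] <;> omega
  have hr : ∀ x, ρ c ≤ ρ (posE i j p a b h (.inr x)) := by
    intro x
    have hx2 := x.2
    by_cases hx : (x : ℕ) < j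
    · rw [← not_lt, hi] <;> rw [posE_inr, if_pos hx] <;> omega
    · by_cases hx' : (x : ℕ) = j
      · apply le_of_eq; congr 1; apply Fin.ext; rw [posE_inr, if_neg hx]; omega
      · apply le_of_lt; apply s2 <;> (try rw [posE_inr, if_neg hx]) <;> omega
  have hcard : (ρ c : ℕ) = i + a := by
    have e1 : (univ.image fun x => ρ (posE i j p a b h (.inl x))) = Finset.Iio (ρ c) := by
      ext y
      simp only [Finset.mem_image, Finset.mem_univ, true_and, Finset.mem_Iio]
      constructor
      · rintro ⟨x, rfl⟩; exact hl x
      · intro hy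
        obtain ⟨z, rfl⟩ := ρ.surjective y
        obtain ⟨z | z, rfl⟩ := (posE i j p a b h).surjective z
        · exact ⟨z, rfl⟩
        · exact absurd hy (not_lt.2 (hr z))
    have e2 := congrArg Finset.card e1
    rw [Finset.card_image_of_injective, Fin.card_Iio] at e2
    · simpa using e2.symm
    · intro x y hxy
      simpa using hxy
  let t : Equiv.Perm (Fin (i + a) ⊕ Fin (j + b)) :=
    (posE i j p a b h).trans (ρ.trans (catE i j p a b h).symm)
  have ht : Set.MapsTo t (Set.range Sum.inl) (Set.range Sum.inl) := by
    rintro _ ⟨x, rfl⟩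
    have h1 := hl x
    rw [Fin.lt_def, hcard] at h1
    refine ⟨⟨_, h1⟩, ?_⟩
    simp only [t, Equiv.trans_apply]
    rw [Equiv.eq_symm_apply]
    apply Fin.ext
    rw [catE_inl]
  obtain ⟨⟨σ, τ⟩, hst⟩ := Equiv.Perm.mem_sumCongrHom_range_of_perm_mapsTo_inl ht
  have hst : Equiv.sumCongr σ τ = t := hst
  have hg : glue i j p a b h σ τ = ρ := by
    unfold glue
    rw [hst]
    ext x
    simp [t]
  have hz : (τ ⟨j, by omega⟩ : ℕ) = 0 := by
    have h1 := glue_inr i j p a b h σ τ ⟨j, by omega⟩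
    have h2 : posE i j p a b h (.inr ⟨j, by omega⟩) = c := by
      apply Fin.ext; rw [posE_inr]; simp [hcv]
    rw [h2, hg, hcard] at h1
    omega
  have := glue_condB_rev i j p a b h ha hb σ τ (hg ▸ H') hz
  exact ⟨i, j, h, σ, τ, this.1, this.2, hg⟩

theorem glue_point (i j p a b : ℕ) (h : i + j = p) (hb : 0 < b)
    (σ : Equiv.Perm (Fin (i + a)))
    (τ : Equiv.Perm (Fin (j + b))) (hτ : CondB j b τ) :
    (glue i j p a b h σ τ ⟨p + a, by omega⟩ : ℕ) = i + a := by
  have h1 := glue_inr i j p a b h σ τ ⟨j, by omega⟩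
  have h2 : posE i j p a b h (.inr ⟨j, by omega⟩) = ⟨p + a, by omega⟩ := by
    apply Fin.ext; rw [posE_inr]; simp
  rw [h2, condB_zero j b hb τ hτ] at h1
  omega

theorem glue_inj (i j p a b : ℕ) (h : i + j = p)
    (σ σ' : Equiv.Perm (Fin (i + a))) (τ τ' : Equiv.Perm (Fin (j + b)))
    (H : glue i j p a b h σ τ = glue i j p a b h σ' τ') : σ = σ' ∧ τ = τ' := by
  constructor
  · ext x
    rw [← glue_inl i j p a b h σ τ, H, glue_inl]
  · ext x
    have h1 := glue_inr i j p a b h σ τ x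
    rw [H, glue_inr] at h1
    omega

theorem ofFn_glue {V : Type*} (i j p a b : ℕ) (h : i + j = p)
    (σ : Equiv.Perm (Fin (i + a))) (τ : Equiv.Perm (Fin (j + b)))
    (g : Fin (p + (a + b)) → V) :
    List.ofFn (fun x => g ((glue i j p a b h σ τ).symm x)) =
      List.ofFn (fun x => g (posE i j p a b h (.inl (σ.symm x)))) ++
      List.ofFn (fun x => g (posE i j p a b h (.inr (τ.symm x)))) := by
  have hn : p + (a + b) = (i + a) + (j + b) := by omega
  rw [List.ofFn_congr hn, List.ofFn_add]
  congr 1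
  · congr 1
    funext x
    congr 1
    rw [Equiv.symm_apply_eq]
    apply Fin.ext
    rw [glue_inl]
    simp
  · congr 1
    funext x
    congr 1
    rw [Equiv.symm_apply_eq]
    apply Fin.ext
    rw [glue_inr]
    simp

theorem letr_inl {V : Type*} (u v w : List V) (i j p a b : ℕ) (h : i + j = p)
    (hp : u.length = p) (ha : v.length = a) (hb : w.length = b)
    (h1 : (v ++ w).length = a + b) (h2 : (u.take i).length = i) (x) :
    letr u (v ++ w) p (a + b) hp h1 (posE i j p a b h (.inl x)) =
      letr (u.take i) v i a h2 ha x := by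
  have hx := x.2
  unfold letr
  simp only [posE_inl, List.getElem_append, h2, hp]
  by_cases hxi : (x : ℕ) < i
  · have : (x : ℕ) < p := by omega
    simp [hxi, this]
  · have : (x : ℕ) - i < v.length := by omega
    simp [hxi, this]

theorem letr_inr {V : Type*} (u v w : List V) (i j p a b : ℕ) (h : i + j = p)
    (hp : u.length = p) (ha : v.length = a) (hb : w.length = b)
    (h1 : (v ++ w).length = a + b) (h2 : (u.drop i).length = j) (x) :
    letr u (v ++ w) p (a + b) hp h1 (posE i j p a b h (.inr x)) =
      letr (u.drop i) w j b h2 hb x := by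
  have hx := x.2
  unfold letr
  simp only [posE_inr, List.getElem_append, h2, hp]
  by_cases hxi : (x : ℕ) < j
  · have : i + (x : ℕ) < p := by omega
    simp [hxi, this]
  · have : ¬ (p + a + ((x : ℕ) - j)) < p := by omega
    have h3 : ¬ (p + a + ((x : ℕ) - j)) - p < v.length := by omega
    have h4 : (p + a + ((x : ℕ) - j)) - p - v.length = x - j := by omega
    simp [hxi, this, h3, h4]

end helpers

theorem statement3 (u v w : List V) (hv : v ≠ []) (hw : w ≠ []) :
    seOp k u (v ++ w) =
      ∑ i ∈ Finset.range (u.length + 1),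
        succOp k (u.take i) v * seOp k (u.drop i) w := by
  classical
  have ha := List.length_pos_iff.2 hv
  have hb := List.length_pos_iff.2 hw
  have hvw : v ++ w ≠ [] := by simp [hv]
  rw [seOp_eq k u (v ++ w) hvw u.length (v.length + w.length) rfl (by simp)]
  have hterm : ∀ i ∈ (Finset.range (u.length + 1)).attach,
      succOp k (u.take i.1) v * seOp k (u.drop i.1) w =
      ∑ στ ∈ (univ.filter (CondA i.1 v.length)) ×ˢ
          (univ.filter (CondB (u.length - i.1) w.length)),
        MonoidAlgebra.single (FreeMonoid.ofList (List.ofFn fun x =>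
          letr u (v ++ w) u.length (v.length + w.length) rfl (by simp)
            ((glue i.1 (u.length - i.1) u.length v.length w.length
              (by have := Finset.mem_range.1 i.2; omega) στ.1 στ.2).symm x))) (1 : k) := by
    rintro ⟨i, hi⟩ _
    have hi' := Finset.mem_range.1 hi
    have h1 : (u.take i).length = i := by simp; omega
    rw [succOp_eq k (u.take i) v hv i v.length h1 rfl,
      seOp_eq k (u.drop i) w hw (u.length - i) w.length (by simp) rfl]
    unfold permSum
    rw [Finset.sum_mul_sum, ← Finset.sum_product']
    refine Finset.sum_congr rfl ?_
    rintro ⟨σ, τ⟩ _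
    rw [ofFn_glue, MonoidAlgebra.single_mul_single, FreeMonoid.ofList_append, one_mul]
    simp only [letr_inl u v w i (u.length - i) u.length v.length w.length (by omega) rfl rfl rfl
      (by simp) h1, letr_inr u v w i (u.length - i) u.length v.length w.length (by omega)
      rfl rfl rfl (by simp) (by simp)]
  rw [← Finset.sum_attach, Finset.sum_congr rfl hterm, Finset.sum_sigma']
  unfold permSum
  symm
  refine Finset.sum_bij (fun s _ => glue s.1.1 (u.length - s.1.1) u.length v.length w.length
      (by have := Finset.mem_range.1 s.1.2; omega) s.2.1 s.2.2) ?_ ?_ ?_ ?_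
  · rintro ⟨⟨i, hi⟩, σ, τ⟩ hs
    simp only [Finset.mem_sigma, Finset.mem_product, Finset.mem_filter, Finset.mem_univ,
      true_and] at hs ⊢
    exact glue_condB _ _ _ _ _ _ ha hb _ _ hs.2.1 hs.2.2
  · rintro ⟨⟨i, hi⟩, σ, τ⟩ hs ⟨⟨i', hi'⟩, σ', τ'⟩ hs' heq
    simp only [Finset.mem_sigma, Finset.mem_product, Finset.mem_filter, Finset.mem_univ,
      true_and] at hs hs' heq
    have hr := Finset.mem_range.1 hi
    have hr' := Finset.mem_range.1 hi'
    have e1 := glue_point i (u.length - i) u.length v.length w.length (by omega) hb σ τ hs.2.2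
    have e2 := glue_point i' (u.length - i') u.length v.length w.length (by omega) hb σ' τ' hs'.2.2
    rw [heq, e2] at e1
    have : i' = i := by omega
    subst this
    obtain ⟨rfl, rfl⟩ := glue_inj _ _ _ _ _ _ _ _ _ _ heq
    rfl
  · intro ρ hρ
    simp only [Finset.mem_filter, Finset.mem_univ, true_and] at hρ
    obtain ⟨i, j, h, σ, τ, h1, h2, h3⟩ := exists_glue _ _ _ ha hb ρ hρ
    have : j = u.length - i := by omega
    subst this
    refine ⟨⟨⟨i, Finset.mem_range.2 (by omega)⟩, σ, τ⟩, ?_, h3⟩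
    simp [h1, h2]
  · intro s _
    rfl
end
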